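/- arXiv:1405.0847 — 4 statements merged into one kernel-verified Lean document; each statement's English description precedes it below -/
import Mathlib

section
/- Let H = (Σ, E_H) be a graph possibly with loops (E_H a symmetric relation on Σ), let T be a finite tree with at least 2 vertices, and let r be any vertex of T. Let α and β be H-colorings of T. Then α can be reconfigured to β (i.e., α and β are connected by a sequence of H-colorings of T in which consecutive colorings differ at exactly one vertex) if and only if there is a walk of even length in H from α(r) to β(r). -/
/-- An `H`-coloring of `G` for a (possibly looped) graph `H` given by a symmetric relation
`E` on the colors: adjacent vertices get `E`-related colors. -/
def IsHColoring {V A : Type*} (G : SimpleGraph V) (E : A → A → Prop) (f : V → A) : Prop :=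
  ∀ u v, G.Adj u v → E (f u) (f v)

/-- Two colorings differ at exactly one vertex. -/
def FDiffOne {V A : Type*} (f g : V → A) : Prop :=
  ∃ v, f v ≠ g v ∧ ∀ u, u ≠ v → f u = g u

/-- One recoloring step: both are `H`-colorings and they differ at exactly one vertex. -/
def RecolorStep {V A : Type*} (G : SimpleGraph V) (E : A → A → Prop) (f g : V → A) :
    Prop :=
  IsHColoring G E f ∧ IsHColoring G E g ∧ FDiffOne f g

/-- There is a walk of even length in `H` from `a` to `b` (a walk of length 0 allowed). -/
def EvenWalk {A : Type*} (E : A → A → Prop) (a b : A) : Prop :=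
  ∃ (k : ℕ) (c : ℕ → A), c 0 = a ∧ c (2 * k) = b ∧ ∀ i < 2 * k, E (c i) (c (i + 1))

namespace IsHColoring

variable {V A : Type*} {G : SimpleGraph V} {E : A → A → Prop} {f g : V → A}

lemma piecewise (hE : ∀ a b, E a b → E b a) (hf : IsHColoring G E f) (hg : IsHColoring G E g)
    (hfg : ∀ u v, G.Adj u v → f u = g u ∨ f v = g v) (S : Finset V)
    [∀ v, Decidable (v ∈ S)] : IsHColoring G E (S.piecewise g f) := by
  intro u v huv
  have h₁ := hf u v huv
  have h₂ := hg u v huv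
  simp only [Finset.piecewise]
  rcases hfg u v huv with h | h <;> split_ifs <;> simp_all

/-- Two colorings that differ on an independent set are connected by recoloring the vertices of
that set one at a time. -/
lemma reconfigure_of_independent [Fintype V] (hE : ∀ a b, E a b → E b a)
    (hf : IsHColoring G E f) (hg : IsHColoring G E g)
    (hfg : ∀ u v, G.Adj u v → f u = g u ∨ f v = g v) :
    Relation.ReflTransGen (RecolorStep G E) f g := by
  classical
  have key : ∀ S : Finset V, Relation.ReflTransGen (RecolorStep G E) f (S.piecewise g f) := by
    intro S
    induction S using Finset.induction_on with
    | empty => simpa using Relation.ReflTransGen.refl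
    | insert a S ha ih =>
      by_cases hag : f a = g a
      · have : (insert a S).piecewise g f = S.piecewise g f := by
          rw [Finset.piecewise_insert, ← hag]
          ext v
          by_cases hv : v = a
          · subst hv; simp [ha]
          · simp [hv]
        rwa [this]
      · refine ih.tail ⟨hf.piecewise hE hg hfg S, hf.piecewise hE hg hfg _, a, ?_, ?_⟩
        · simpa [ha] using hag
        · intro u hu
          simp [Finset.piecewise, hu]
  simpa using key Finset.univ

end IsHColoring

lemma RecolorStep.symm {V A : Type*} {G : SimpleGraph V} {E : A → A → Prop} {f g : V → A}
    (h : RecolorStep G E f g) : RecolorStep G E g f := by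
  obtain ⟨hf, hg, v, hv, hu⟩ := h
  exact ⟨hg, hf, v, hv.symm, fun u huv => (hu u huv).symm⟩

lemma RecolorStep.reflTransGen_symm {V A : Type*} {G : SimpleGraph V} {E : A → A → Prop}
    {f g : V → A} (h : Relation.ReflTransGen (RecolorStep G E) f g) :
    Relation.ReflTransGen (RecolorStep G E) g f := by
  induction h with
  | refl => exact .refl
  | tail _ hs ih => exact ih.head hs.symm

lemma evenWalk_iff_reflTransGen {A : Type*} {E : A → A → Prop} {a b : A} :
    EvenWalk E a b ↔ Relation.ReflTransGen (fun x y => ∃ m, E x m ∧ E m y) a b := by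
  constructor
  · rintro ⟨k, c, rfl, rfl, hc⟩
    induction k with
    | zero => exact .refl
    | succ k ih =>
      exact (ih fun i hi => hc i (by omega)).tail
        ⟨c (2 * k + 1), hc _ (by omega), hc (2 * k + 1) (by omega)⟩
  · intro h
    induction h with
    | refl => exact ⟨0, fun _ => a, rfl, rfl, by simp⟩
    | @tail y z _ hs ih =>
      obtain ⟨m, hm, hm'⟩ := hs
      obtain ⟨k, c, h0, hk, hc⟩ := ih
      refine ⟨k + 1, fun i => if i ≤ 2 * k then c i else if i = 2 * k + 1 then m else z,
        by simpa using h0, by simp [mul_add], fun i hi => ?_⟩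
      rcases lt_trichotomy i (2 * k) with h | rfl | h
      · simpa [h.le, Nat.succ_le_of_lt h] using hc i h
      · simpa [hk] using hm
      · obtain rfl : i = 2 * k + 1 := by omega
        simpa using hm'

/-- The parent function of a rooted tree. -/
lemma SimpleGraph.IsTree.exists_parent {V : Type*} {T : SimpleGraph V} (hT : T.IsTree) (r : V) :
    ∃ p : V → V, (∀ u v, T.Adj u v → T.dist r v = T.dist r u + 1 → u = p v) ∧
      ∀ v, v ≠ r → T.Adj v (p v) ∧ T.dist r v = T.dist r (p v) + 1 := by
  choose P hP using fun v => hT.connected.exists_walk_length_eq_dist v r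
  refine ⟨fun v => (P v).snd, fun u v huv hd => ?_, fun v hv => ?_⟩
  · have hlen : (SimpleGraph.Walk.cons huv.symm (P u)).length = T.dist v r := by
      rw [SimpleGraph.Walk.length_cons, hP, T.dist_comm, T.dist_comm (u := v), hd]
    have := (hT.existsUnique_path v r).unique
      (SimpleGraph.Walk.isPath_of_length_eq_dist _ hlen)
      (SimpleGraph.Walk.isPath_of_length_eq_dist _ (hP v))
    simp [← this]
  · have hnil : ¬ (P v).Nil := SimpleGraph.Walk.not_nil_of_ne hv
    have hadj := (P v).adj_snd hnil
    refine ⟨hadj, ?_⟩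
    have h₁ := SimpleGraph.Walk.length_tail_add_one hnil
    have h₂ := SimpleGraph.dist_le (P v).tail
    rw [hP, T.dist_comm (u := v)] at h₁
    rw [T.dist_comm] at h₂
    rcases hT.dist_eq_dist_add_one_of_adj r hadj with h | h <;> omega

section Tree

variable {V A : Type*} {T : SimpleGraph V} {E : A → A → Prop} {r : V}

/-- The coloring of a tree by two colors according to the parity of the distance to the root. -/
noncomputable def alternating (T : SimpleGraph V) (r : V) (a b : A) (v : V) : A :=
  if Even (T.dist r v) then a else b

lemma isHColoring_alternating (hT : T.IsTree) (hE : ∀ a b, E a b → E b a) {a b : A}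
    (hab : E a b) : IsHColoring T E (alternating T r a b) := by
  intro u v huv
  have hba := hE _ _ hab
  unfold alternating
  rcases hT.dist_eq_dist_add_one_of_adj r huv with h | h <;> rw [h] <;>
    simp only [Nat.even_add_one] <;> split_ifs <;> assumption

variable [Fintype V]

lemma reconfigure_comp_fold (hT : T.IsTree) (hE : ∀ a b, E a b → E b a) {p : V → V}
    (hp : ∀ u v, T.Adj u v → T.dist r v = T.dist r u + 1 → u = p v)
    (hp' : ∀ v, v ≠ r → T.Adj v (p v) ∧ T.dist r v = T.dist r (p v) + 1)
    {f : V → A} (hf : IsHColoring T E f) :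
    (IsHColoring T E fun v => f (if 2 ≤ T.dist r v then p (p v) else v)) ∧
    Relation.ReflTransGen (RecolorStep T E) f
      (fun v => f (if 2 ≤ T.dist r v then p (p v) else v)) := by
  have hne : ∀ v, 0 < T.dist r v → v ≠ r := by
    rintro v hv rfl
    simp at hv
  have hcol : ∀ k, 2 ≤ k →
      IsHColoring T E fun v => f (if k ≤ T.dist r v then p (p v) else v) := by
    intro k hk
    have key : ∀ u v, T.Adj u v → T.dist r v = T.dist r u + 1 →
        E (f (if k ≤ T.dist r u then p (p u) else u))
          (f (if k ≤ T.dist r v then p (p v) else v)) := by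
      intro u v huv hd
      have hu : p v = u := (hp u v huv hd).symm
      rw [hu]
      split_ifs with h₁ h₂ h₂
      · obtain ⟨-, h⟩ := hp' u (hne u (by omega))
        exact hE _ _ (hf _ _ (hp' (p u) (hne _ (by omega))).1)
      · omega
      · exact hf _ _ (hp' u (hne u (by omega))).1
      · exact hf _ _ huv
    intro u v huv
    rcases hT.dist_eq_dist_add_one_of_adj r huv with h | h
    · exact hE _ _ (key v u huv.symm h)
    · exact key u v huv h
  refine ⟨hcol 2 le_rfl, ?_⟩
  have hstep : ∀ n, Relation.ReflTransGen (RecolorStep T E)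
      (fun v => f (if 2 + n ≤ T.dist r v then p (p v) else v))
      (fun v => f (if 2 ≤ T.dist r v then p (p v) else v)) := by
    intro n
    induction n with
    | zero => exact .refl
    | succ n ih =>
      refine .trans ?_ ih
      refine (hcol _ (by omega)).reconfigure_of_independent hE (hcol _ (by omega)) ?_
      intro u v huv
      have := hT.dist_ne_of_adj r huv
      by_cases hu : T.dist r u = 2 + n
      · right
        have : 2 + (n + 1) ≤ T.dist r v ↔ 2 + n ≤ T.dist r v := by omega
        simp only [this]
      · left
        have : 2 + (n + 1) ≤ T.dist r u ↔ 2 + n ≤ T.dist r u := by omega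
        simp only [this]
  convert hstep (∑ v, T.dist r v) using 1
  ext v
  have := Finset.single_le_sum (f := fun v => T.dist r v) (fun _ _ => Nat.zero_le _)
    (Finset.mem_univ v)
  rw [if_neg]
  omega

lemma reconfigure_alternating (hT : T.IsTree) (hE : ∀ a b, E a b → E b a) {w : V}
    (hw : T.Adj r w) {f : V → A} (hf : IsHColoring T E f) :
    Relation.ReflTransGen (RecolorStep T E) f (alternating T r (f r) (f w)) := by
  obtain ⟨p, hp, hp'⟩ := hT.exists_parent r
  have hd : ∀ v, 2 ≤ T.dist r v → T.dist r v = T.dist r (p (p v)) + 2 := by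
    intro v hv
    obtain ⟨-, h⟩ := hp' v (by rintro rfl; simp at hv)
    obtain ⟨-, h'⟩ := hp' (p v) (by intro hr; rw [hr, SimpleGraph.dist_self] at h; omega)
    omega
  -- iterated folding moves every vertex to distance at most one from the root
  have key : ∀ n, ∃ s : V → V, (∀ v, T.dist r (s v) ≤ 1 ∨ T.dist r (s v) + n ≤ T.dist r v) ∧
      (∀ v, Even (T.dist r (s v)) ↔ Even (T.dist r v)) ∧
      IsHColoring T E (f ∘ s) ∧ Relation.ReflTransGen (RecolorStep T E) f (f ∘ s) := by
    intro n
    induction n with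
    | zero => exact ⟨id, fun v => .inr le_rfl, fun v => Iff.rfl, hf, .refl⟩
    | succ n ih =>
      obtain ⟨s, hs, hpar, hcol, hrec⟩ := ih
      obtain ⟨hcol', hrec'⟩ := reconfigure_comp_fold hT hE hp hp' hcol
      refine ⟨fun v => s (if 2 ≤ T.dist r v then p (p v) else v), fun v => ?_, fun v => ?_,
        hcol', hrec.trans hrec'⟩
      · dsimp only
        split_ifs with h
        · have := hd v h
          have := hs (p (p v))
          omega
        · have := hs v
          omega
      · rw [hpar]
        split_ifs with h
        · rw [hd v h]
          simp [Nat.even_add]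
        · rfl
  obtain ⟨s, hs, hpar, hcol, hrec⟩ := key (∑ v, T.dist r v)
  have heven : ∀ v, Even (T.dist r v) → s v = r := by
    intro v hv
    have hle := Finset.single_le_sum (f := fun v => T.dist r v) (fun _ _ => Nat.zero_le _)
      (Finset.mem_univ v)
    have h1 : T.dist r (s v) ≤ 1 := by
      have := hs v
      omega
    have h2 := (hpar v).2 hv
    have h3 : T.dist r (s v) = 0 := by
      obtain ⟨m, hm⟩ := h2
      omega
    exact ((hT.connected.dist_eq_zero_iff).1 h3).symm
  refine hrec.trans (hcol.reconfigure_of_independent hE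
    (isHColoring_alternating hT hE (hf r w hw)) ?_)
  intro u v huv
  have key2 : ∀ v, Even (T.dist r v) → (f ∘ s) v = alternating T r (f r) (f w) v := by
    intro v hv
    simp [alternating, hv, heven v hv]
  by_cases hu : Even (T.dist r u)
  · exact .inl (key2 u hu)
  · refine .inr (key2 v ?_)
    rcases hT.dist_eq_dist_add_one_of_adj r huv with h | h
    · rw [h, Nat.even_add_one, not_not] at hu
      exact hu
    · rw [h, Nat.even_add_one]
      exact hu

lemma alternating_reconfigure_alternating (hT : T.IsTree) (hE : ∀ a b, E a b → E b a)
    {a a' : A} (h : Relation.ReflTransGen (fun x y => ∃ m, E x m ∧ E m y) a a') :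
    ∀ b b', E a b → E a' b' → Relation.ReflTransGen (RecolorStep T E)
      (alternating T r a b) (alternating T r a' b') := by
  have hparity : ∀ u v, T.Adj u v → (Even (T.dist r u) ↔ ¬ Even (T.dist r v)) := by
    intro u v huv
    rcases hT.dist_eq_dist_add_one_of_adj r huv with h | h <;> rw [h, Nat.even_add_one]
    exact not_not.symm
  have hright : ∀ a b b', E a b → E a b' → Relation.ReflTransGen (RecolorStep T E)
      (alternating T r a b) (alternating T r a b') := by
    intro a b b' hb hb'
    refine (isHColoring_alternating hT hE hb).reconfigure_of_independent hE
      (isHColoring_alternating hT hE hb') fun u v huv => ?_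
    simp only [alternating, hparity u v huv]
    by_cases hv : Even (T.dist r v) <;> simp only [hv, not_true, not_false_eq_true, if_true,
      if_false, true_or, or_true]
  have hleft : ∀ a a' b, E a b → E a' b → Relation.ReflTransGen (RecolorStep T E)
      (alternating T r a b) (alternating T r a' b) := by
    intro a a' b hb hb'
    refine (isHColoring_alternating hT hE hb).reconfigure_of_independent hE
      (isHColoring_alternating hT hE hb') fun u v huv => ?_
    simp only [alternating, hparity u v huv]
    by_cases hv : Even (T.dist r v) <;> simp only [hv, not_true, not_false_eq_true, if_true,
      if_false, true_or, or_true]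
  induction h with
  | refl => exact hright a
  | @tail y z _ hs ih =>
    obtain ⟨m, hm, hm'⟩ := hs
    intro b b' hb hb'
    exact ((ih b m hb hm).trans (hleft y z m hm (hE _ _ hm'))).trans
      (hright z m b' (hE _ _ hm') hb')

end Tree

/-- For a tree `T` with at least 2 vertices and any root `r`, two `H`-colorings of `T` can
be reconfigured into one another iff there is a walk of even length in `H` between the
colors they assign to `r`. -/
theorem stmt13 {V A : Type*} [Fintype V] (T : SimpleGraph V) (hT : T.IsTree)
    (hV : 2 ≤ Fintype.card V) (E : A → A → Prop) (hE : ∀ a b, E a b → E b a)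
    (r : V) (α β : V → A) (hα : IsHColoring T E α) (hβ : IsHColoring T E β) :
    Relation.ReflTransGen (RecolorStep T E) α β ↔ EvenWalk E (α r) (β r) := by
  have : Nontrivial V := Fintype.one_lt_card_iff_nontrivial.1 hV
  obtain ⟨w, hw⟩ : ∃ w, T.Adj r w := hT.connected.preconnected.exists_adj_of_nontrivial r
  rw [evenWalk_iff_reflTransGen]
  constructor
  · intro h
    refine Relation.ReflTransGen.lift' (fun f : V → A => f r) ?_ _ _ h
    rintro f g ⟨hf, hg, v, hv, hfg⟩
    by_cases hvr : r = v
    · have hwv : f w = g w := hfg w (hvr ▸ hw.ne')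
      exact .single ⟨f w, hf r w hw, hwv ▸ hg w r hw.symm⟩
    · change Relation.ReflTransGen _ (f r) (g r)
      rw [hfg r hvr]
  · intro h
    exact ((reconfigure_alternating hT hE hw hα).trans
      (alternating_reconfigure_alternating hT hE h _ _ (hα r w hw) (hβ r w hw))).trans
      (RecolorStep.reflTransGen_symm (reconfigure_alternating hT hE hw hβ))
end

section
/- Let H = (Σ, E_H) be a graph possibly with loops (E_H a symmetric relation on Σ), let T be a finite tree with root r, and let γ be an H-coloring of T. Then γ can be reconfigured, by a sequence of H-colorings of T in which consecutive colorings differ at exactly one vertex, to an H-coloring γ′ such that γ′ agrees with γ on r and on all vertices at distance 1 from r, and γ′(v) equals γ′ evaluated at the grandparent of v for every vertex v at distance at least 2 from r (the grandparent of v being the vertex at distance 2 from v on the path from v to r). -/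
/-- If two `H`-colorings differ on no two adjacent vertices, then the first can be reconfigured
to agree with the second on any finite set of vertices. -/
theorem IsHColoring.reflTransGen_piecewise {V A : Type*} [DecidableEq V]
    {G : SimpleGraph V} {E : A → A → Prop} {f g : V → A} (hf : IsHColoring G E f)
    (hg : IsHColoring G E g) (hfg : ∀ u v, G.Adj u v → f u = g u ∨ f v = g v) (S : Finset V) :
    Relation.ReflTransGen (RecolorStep G E) f (S.piecewise g f) := by
  have hcol (S : Finset V) : IsHColoring G E (S.piecewise g f) := by
    intro u v huv
    have h₁ := hf u v huv
    have h₂ := hg u v huv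
    simp only [Finset.piecewise]
    split_ifs <;> rcases hfg u v huv with h | h <;> simp_all
  induction S using Finset.induction_on with
  | empty => simpa using Relation.ReflTransGen.refl
  | insert a S ha ih =>
    by_cases h : f a = g a
    · have heq : (insert a S).piecewise g f = S.piecewise g f := by
        rw [Finset.piecewise_insert, Function.update_eq_self_iff]
        simp [ha, h]
      rwa [heq]
    · refine ih.tail ⟨hcol S, hcol _, a, ?_, fun u hu => ?_⟩
      · simpa [ha] using h
      · rw [Finset.piecewise_insert, Function.update_of_ne hu]

/-- If two `H`-colorings of a finite graph differ on no two adjacent vertices, then the first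
can be reconfigured into the second. -/
theorem IsHColoring.reflTransGen_of_diff_indep {V A : Type*} [Fintype V]
    {G : SimpleGraph V} {E : A → A → Prop} {f g : V → A} (hf : IsHColoring G E f)
    (hg : IsHColoring G E g) (hfg : ∀ u v, G.Adj u v → f u = g u ∨ f v = g v) :
    Relation.ReflTransGen (RecolorStep G E) f g := by
  classical
  simpa using hf.reflTransGen_piecewise hg hfg Finset.univ

/-- In a connected graph every vertex other than the root has a neighbor closer to the root. -/
theorem SimpleGraph.Connected.exists_adj_dist_add_one {V : Type*} {G : SimpleGraph V}
    (hG : G.Connected) (r v : V) (hv : 0 < G.dist r v) :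
    ∃ u, G.Adj u v ∧ G.dist r u + 1 = G.dist r v := by
  obtain ⟨w, hw⟩ := hG.exists_walk_length_eq_dist r v
  have hnil : ¬ w.Nil := SimpleGraph.Walk.not_nil_iff_lt_length.2 (hw ▸ hv)
  have hadj := w.adj_penultimate hnil
  refine ⟨w.penultimate, hadj, ?_⟩
  have h₁ := SimpleGraph.dist_le w.dropLast
  have h₂ := w.length_dropLast_add_one hnil
  have h₃ := hG.dist_triangle (u := r) (v := w.penultimate) (w := v)
  rw [SimpleGraph.dist_eq_one_iff_adj.2 hadj] at h₃
  omega

/-- In an acyclic connected graph, the neighbor of a vertex that is closer to the root is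
unique. -/
theorem SimpleGraph.IsTree.eq_of_adj_of_dist_add_one {V : Type*} {T : SimpleGraph V}
    (hT : T.IsTree) {r u v w : V} (hu : T.Adj u v) (hw : T.Adj w v)
    (hdu : T.dist r u + 1 = T.dist r v) (hdw : T.dist r w + 1 = T.dist r v) : u = w := by
  obtain ⟨p, hp⟩ := hT.connected.exists_walk_length_eq_dist r u
  obtain ⟨q, hq⟩ := hT.connected.exists_walk_length_eq_dist r w
  have hp' := (p.concat hu).isPath_of_length_eq_dist (by simp [hp, hdu])
  have hq' := (q.concat hw).isPath_of_length_eq_dist (by simp [hq, hdw])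
  have h := (hT.existsUnique_path r v).unique hp' hq'
  simpa using congrArg SimpleGraph.Walk.penultimate h

/-- The coloring obtained from `γ` by folding all vertices of depth greater than `k + 1` onto
their ancestors of depth `k` or `k + 1`, where `d` is the depth and `p` the parent map. -/
def foldColoring {V A : Type*} (d : V → ℕ) (p : V → V) (γ : V → A) (k : ℕ) (v : V) : A :=
  γ (p^[2 * ((d v - k) / 2)] v)

/-- The `i`-th ancestor of a vertex lies `i` levels above it. -/
theorem depth_iterate_parent {V : Type*} {d : V → ℕ} {p : V → V}
    (hd : ∀ v, 0 < d v → d (p v) + 1 = d v) (i : ℕ) (v : V) (hi : i ≤ d v) :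
    d (p^[i] v) + i = d v := by
  induction i with
  | zero => rfl
  | succ i ih =>
    have h := ih (by omega)
    rw [Function.iterate_succ_apply']
    have := hd (p^[i] v) (by omega)
    omega

/-- A folded coloring respects `E` on every edge from a vertex to its parent. -/
theorem foldColoring_edge {V A : Type*} {E : A → A → Prop} (hE : ∀ a b, E a b → E b a)
    {d : V → ℕ} {p : V → V} {γ : V → A} (hd : ∀ v, 0 < d v → d (p v) + 1 = d v)
    (hγ : ∀ v, 0 < d v → E (γ (p v)) (γ v)) (k : ℕ) (v : V) (hv : 0 < d v) :
    E (foldColoring d p γ k (p v)) (foldColoring d p γ k v) := by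
  have hpv := hd v hv
  unfold foldColoring
  rw [← Function.iterate_succ_apply]
  rcases Nat.lt_or_ge (d v) (k + 1) with hk | hk
  · have h₁ : (d (p v) - k) / 2 = 0 := by omega
    have h₂ : (d v - k) / 2 = 0 := by omega
    simpa [h₁, h₂] using hγ v hv
  · rcases Nat.even_or_odd' (d v - k) with ⟨j, hj | hj⟩
    · obtain ⟨i, rfl⟩ : ∃ i, j = i + 1 := ⟨j - 1, by omega⟩
      have h₁ : (d (p v) - k) / 2 = i := by omega
      have h₂ : (d v - k) / 2 = i + 1 := by omega
      have h := depth_iterate_parent hd (2 * i + 1) v (by omega)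
      rw [h₁, h₂, show 2 * (i + 1) = (2 * i + 1) + 1 by ring,
        Function.iterate_succ_apply' p (2 * i + 1)]
      exact hE _ _ (hγ _ (by omega))
    · have h₁ : (d (p v) - k) / 2 = j := by omega
      have h₂ : (d v - k) / 2 = j := by omega
      have h := depth_iterate_parent hd (2 * j) v (by omega)
      rw [h₁, h₂, Function.iterate_succ_apply']
      exact hγ _ (by omega)

/-- Any `H`-coloring `γ` of a rooted tree `T` can be reconfigured to an `H`-coloring `γ'`
agreeing with `γ` on the root `r` and on the vertices at distance 1 from `r`, and giving
every vertex at distance at least 2 from `r` the same color as its grandparent (the vertex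
at distance 2 from `v`, at distance `dist r v − 2` from `r`, on the path from `v` to `r`). -/
theorem stmt14 {V A : Type*} [Fintype V] (T : SimpleGraph V) (hT : T.IsTree) (r : V)
    (E : A → A → Prop) (hE : ∀ a b, E a b → E b a)
    (γ : V → A) (hγ : IsHColoring T E γ) :
    ∃ γ' : V → A, Relation.ReflTransGen (RecolorStep T E) γ γ' ∧
      γ' r = γ r ∧
      (∀ v, T.dist r v = 1 → γ' v = γ v) ∧
      (∀ v, 2 ≤ T.dist r v →
        ∀ g, T.dist v g = 2 → T.dist r g + 2 = T.dist r v → γ' v = γ' g) := by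
  choose! p hpadj hpd using hT.connected.exists_adj_dist_add_one r
  have hpar {u v : V} (huv : T.Adj u v) (hd : T.dist r u + 1 = T.dist r v) : p v = u :=
    hT.eq_of_adj_of_dist_add_one (hpadj v (by omega)) huv (hpd v (by omega)) hd
  have hcol (k : ℕ) : IsHColoring T E (foldColoring (T.dist r) p γ k) := by
    have hedge := foldColoring_edge hE hpd (fun v hv => hγ _ _ (hpadj v hv)) k
    intro u v huv
    rcases hT.dist_eq_dist_add_one_of_adj r huv with h | h
    · rw [← hpar huv.symm h.symm]
      exact hE _ _ (hedge u (by omega))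
    · rw [← hpar huv h.symm]
      exact hedge v (by omega)
  have hstep (k : ℕ) : Relation.ReflTransGen (RecolorStep T E)
      (foldColoring (T.dist r) p γ (k + 1)) (foldColoring (T.dist r) p γ k) := by
    refine (hcol _).reflTransGen_of_diff_indep (hcol _) fun u v huv => ?_
    have h : (T.dist r u - (k + 1)) / 2 = (T.dist r u - k) / 2 ∨
        (T.dist r v - (k + 1)) / 2 = (T.dist r v - k) / 2 := by
      rcases hT.dist_eq_dist_add_one_of_adj r huv with h | h <;> omega
    unfold foldColoring
    exact h.imp (fun h => by rw [h]) (fun h => by rw [h])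
  have hreach (k : ℕ) : Relation.ReflTransGen (RecolorStep T E)
      (foldColoring (T.dist r) p γ k) (foldColoring (T.dist r) p γ 0) := by
    induction k with
    | zero => exact .refl
    | succ k ih => exact (hstep k).trans ih
  refine ⟨foldColoring (T.dist r) p γ 0, ?_, ?_, fun v hv => ?_, fun v hv g hvg hg => ?_⟩
  · obtain ⟨N, hN⟩ := (Set.finite_range (T.dist r)).bddAbove
    have h₀ : foldColoring (T.dist r) p γ N = γ := by
      funext v
      simp [foldColoring, Nat.sub_eq_zero_of_le (hN (Set.mem_range_self v))]
    simpa only [h₀] using hreach N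
  · simp [foldColoring]
  · simp [foldColoring, hv]
  · obtain ⟨m, hvm, hmg⟩ : ∃ m, T.Adj m v ∧ T.Adj g m := by
      obtain ⟨m, hmg, hm⟩ := hT.connected.exists_adj_dist_add_one v g (by omega)
      exact ⟨m, (SimpleGraph.dist_eq_one_iff_adj.1 (by omega)).symm, hmg.symm⟩
    have h₁ := hT.dist_eq_dist_add_one_of_adj r hvm
    have h₂ := hT.dist_eq_dist_add_one_of_adj r hmg
    have hm : p v = m := hpar hvm (by omega)
    have hpp : p m = g := hpar hmg (by omega)
    have h : (T.dist r v - 0) / 2 = (T.dist r g - 0) / 2 + 1 := by omega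
    simp only [foldColoring, h, Nat.mul_add, Function.iterate_add_apply]
    simp [hm, hpp]
end

section
/- Let H = (Σ, E_H) be a graph possibly with loops (E_H a symmetric relation on Σ) and G a simple graph. Suppose α and β are H-colorings of G connected by a sequence of H-colorings of G in which consecutive colorings differ at exactly one vertex. Then for every vertex v of G that has at least one neighbor, there is a walk of even length in H from α(v) to β(v). -/
theorem EvenWalk.refl {A : Type*} (E : A → A → Prop) (a : A) : EvenWalk E a a :=
  ⟨0, fun _ => a, rfl, rfl, by simp⟩

/-- An even walk stays even when extended by two edges. -/
theorem EvenWalk.extend {A : Type*} {E : A → A → Prop} {a b x d : A} (h : EvenWalk E a b)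
    (hbx : E b x) (hxd : E x d) : EvenWalk E a d := by
  obtain ⟨k, c, h0, hk, hc⟩ := h
  refine ⟨k + 1, fun i => if i ≤ 2 * k then c i else if i = 2 * k + 1 then x else d,
    by simpa using h0, by simp [show ¬ 2 * (k + 1) ≤ 2 * k by omega,
      show 2 * (k + 1) ≠ 2 * k + 1 by omega], fun i hi => ?_⟩
  obtain h | rfl | rfl : i < 2 * k ∨ i = 2 * k ∨ i = 2 * k + 1 := by omega
  · simpa [h.le, Nat.succ_le_of_lt h] using hc i h
  · simpa [hk] using hbx
  · simpa using hxd

/-- If two `H`-colorings of `G` are connected by single-vertex recolorings through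
`H`-colorings, then for every vertex `v` with at least one neighbor there is a walk of
even length in `H` from `α v` to `β v`. -/
theorem stmt15 {V A : Type*} (G : SimpleGraph V) (E : A → A → Prop)
    (hE : ∀ a b, E a b → E b a)
    (α β : V → A) (hα : IsHColoring G E α) (hβ : IsHColoring G E β)
    (hreach : Relation.ReflTransGen (RecolorStep G E) α β) :
    ∀ v, (∃ u, G.Adj v u) → EvenWalk E (α v) (β v) := by
  rintro v ⟨u, huv⟩
  induction hreach with
  | refl => exact EvenWalk.refl E (α v)
  | @tail f g _ hfg ih =>
    obtain ⟨hf, hg, w, _, hw⟩ := hfg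
    by_cases hvw : v = w
    · subst hvw
      have hu : f u = g u := hw u huv.ne'
      refine (ih hf).extend (hf v u huv) ?_
      rw [hu]
      exact hg u v huv.symm
    · rw [← hw v hvw]
      exact ih hf
end

section
/- Let H = (Σ, E_H) be a digraph and n ≥ 1. Let the directed cycle D have vertices w₁,…,w_{3n} and arcs w_i → w_{i+1} (indices mod 3n); an H-coloring of D is a map f with (f(w_i), f(w_{i+1 mod 3n})) ∈ E_H for all i. Let H′ = (Σ × {0,1,2}, E′) be the graph with (symmetric) edges {(a,i), (b, i+1 mod 3)} for every (a,b) ∈ E_H and i ∈ {0,1,2}. For an H-coloring α of D define the H′-coloring α′ of the underlying undirected cycle by α′(w_i) = (α(w_i), i mod 3). Then for all H-colorings α, β of D: α and β are connected by a sequence of H-colorings of D in which consecutive colorings differ at exactly one vertex, if and only if α′ and β′ are connected by a sequence of H′-colorings of the undirected cycle in which consecutive colorings differ at exactly one vertex. Moreover, in any such sequence of H′-colorings starting from α′, the second coordinate of the color of each vertex w_i remains i mod 3 throughout. -/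
/-- The (undirected) cycle on `ZMod n` with edges `v` – `v + 1`. -/
def cycleGraph (n : ℕ) : SimpleGraph (ZMod n) :=
  SimpleGraph.fromRel fun x y => y = x + 1

/-- An `H`-coloring of the directed cycle on `ZMod n` (arcs `i → i + 1`) for a digraph
`H = (A, E)`: consecutive colors are related by the arc relation `E`, in the direction of
the arcs. -/
def DirCycleCol {A : Type*} (n : ℕ) (E : A → A → Prop) (f : ZMod n → A) : Prop :=
  ∀ i : ZMod n, E (f i) (f (i + 1))

/-- The symmetric edge relation `E′` of `H′` on `Σ × {0,1,2}`: the (undirected) edges are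
`{(a, i), (b, i + 1 mod 3)}` for every arc `(a, b)` of `E` and `i ∈ {0,1,2}`. -/
def pairedRel {A : Type*} (E : A → A → Prop) : A × ZMod 3 → A × ZMod 3 → Prop :=
  fun p q => (E p.1 q.1 ∧ q.2 = p.2 + 1) ∨ (E q.1 p.1 ∧ p.2 = q.2 + 1)

/-- The coloring `α′` of the underlying undirected cycle: `α′(wᵢ) = (α(wᵢ), i mod 3)`. -/
def liftCol {A : Type*} (n : ℕ) (f : ZMod n → A) : ZMod n → A × ZMod 3 :=
  fun i => (f i, (i.val : ZMod 3))

theorem val_add_one_cast_three {n : ℕ} (hn : 1 ≤ n) (i : ZMod (3 * n)) :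
    ((i + 1).val : ZMod 3) = (i.val : ZMod 3) + 1 := by
  have : NeZero (3 * n) := ⟨by omega⟩
  have h := map_add (ZMod.castHom (Dvd.intro n rfl : 3 ∣ 3 * n) (ZMod 3)) i 1
  rw [map_one, ZMod.castHom_apply, ZMod.castHom_apply] at h
  rwa [ZMod.natCast_val, ZMod.natCast_val]

theorem cycleGraph_adj_add_one {n : ℕ} (hn : 1 ≤ n) (i : ZMod (3 * n)) :
    (cycleGraph (3 * n)).Adj i (i + 1) := by
  refine (SimpleGraph.fromRel_adj _ _ _).2 ⟨fun h => ?_, Or.inl rfl⟩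
  have h' := val_add_one_cast_three hn i
  rw [← h] at h'
  exact absurd h' (by generalize (i.val : ZMod 3) = a; revert a; decide)

theorem isHColoring_liftCol {A : Type*} {E : A → A → Prop} {n : ℕ} (hn : 1 ≤ n)
    {f : ZMod (3 * n) → A} (hf : DirCycleCol (3 * n) E f) :
    IsHColoring (cycleGraph (3 * n)) (pairedRel E) (liftCol (3 * n) f) := by
  intro u v huv
  rcases ((SimpleGraph.fromRel_adj _ _ _).1 huv).2 with rfl | rfl
  · exact Or.inl ⟨hf u, val_add_one_cast_three hn u⟩
  · exact Or.inr ⟨hf v, val_add_one_cast_three hn v⟩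

theorem dirCycleCol_fst_of_isHColoring {A : Type*} {E : A → A → Prop} {n : ℕ} (hn : 1 ≤ n)
    {f : ZMod (3 * n) → A × ZMod 3}
    (hf : IsHColoring (cycleGraph (3 * n)) (pairedRel E) f)
    (hsnd : ∀ i, (f i).2 = (i.val : ZMod 3)) :
    DirCycleCol (3 * n) E (fun i => (f i).1) := by
  intro i
  rcases hf i (i + 1) (cycleGraph_adj_add_one hn i) with h | h
  · exact h.1
  · have h' := h.2
    rw [hsnd, hsnd, val_add_one_cast_three hn] at h'
    exact absurd h' (by generalize (i.val : ZMod 3) = a; revert a; decide)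

theorem FDiffOne.liftCol {A : Type*} {n : ℕ} {f g : ZMod n → A} (h : FDiffOne f g) :
    FDiffOne (liftCol n f) (liftCol n g) := by
  obtain ⟨v, hv, huv⟩ := h
  exact ⟨v, fun h => hv (congrArg Prod.fst h), fun u hu => Prod.ext (huv u hu) rfl⟩

theorem FDiffOne.fst {V A B : Type*} {f g : V → A × B} (h : FDiffOne f g)
    (hsnd : ∀ i, (f i).2 = (g i).2) : FDiffOne (fun i => (f i).1) (fun i => (g i).1) := by
  obtain ⟨v, hv, huv⟩ := h
  exact ⟨v, fun h => hv (Prod.ext h (hsnd v)), fun u hu => congrArg Prod.fst (huv u hu)⟩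

/-- A recoloring step keeps the second coordinates: the two neighbors of the recolored vertex
have distinct second coordinates, which leave a single value for the vertex between them. -/
theorem RecolorStep.snd_eq {A : Type*} {E : A → A → Prop} {n : ℕ} (hn : 1 ≤ n)
    {f g : ZMod (3 * n) → A × ZMod 3}
    (h : RecolorStep (cycleGraph (3 * n)) (pairedRel E) f g)
    (hsnd : ∀ i, (f i).2 = (i.val : ZMod 3)) (i : ZMod (3 * n)) :
    (g i).2 = (i.val : ZMod 3) := by
  obtain ⟨-, hg, v, -, huv⟩ := h
  by_cases hiv : i = v
  swap
  · rw [← huv i hiv, hsnd]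
  subst hiv
  obtain ⟨j, rfl⟩ : ∃ j, i = j + 1 := ⟨i - 1, by ring⟩
  have hadj := cycleGraph_adj_add_one hn j
  have hadj' := cycleGraph_adj_add_one hn (j + 1)
  have hl := hg _ _ hadj
  have hr := hg _ _ hadj'
  have el : (g j).2 = (j.val : ZMod 3) := by rw [← huv j hadj.ne, hsnd]
  have er : (g (j + 1 + 1)).2 = (j.val : ZMod 3) + 1 + 1 := by
    rw [← huv _ hadj'.ne', hsnd, val_add_one_cast_three hn, val_add_one_cast_three hn]
  have hl' := hl.imp And.right And.right
  have hr' := hr.imp And.right And.right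
  rw [el] at hl'
  rw [er] at hr'
  rw [val_add_one_cast_three hn]
  generalize (j.val : ZMod 3) = a at *
  generalize (g (j + 1)).2 = c at *
  clear * - hl' hr'
  revert a c
  decide

theorem snd_eq_of_reflTransGen_recolorStep {A : Type*} {E : A → A → Prop} {n : ℕ} (hn : 1 ≤ n)
    {f g : ZMod (3 * n) → A × ZMod 3}
    (h : Relation.ReflTransGen (RecolorStep (cycleGraph (3 * n)) (pairedRel E)) f g)
    (hsnd : ∀ i, (f i).2 = (i.val : ZMod 3)) : ∀ i, (g i).2 = (i.val : ZMod 3) := by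
  induction h with
  | refl => exact hsnd
  | tail _ hstep ih => exact hstep.snd_eq hn ih

/-- For the directed cycle of length `3n` and `H`-colorings `α, β` of it: `α′` is an
`H′`-coloring of the underlying undirected cycle; `α` and `β` are connected by
single-vertex recolorings through `H`-colorings of the directed cycle iff `α′` and `β′`
are connected by single-vertex recolorings through `H′`-colorings of the undirected
cycle; and in any such sequence of `H′`-colorings starting from `α′`, the second
coordinate of the color of each vertex `wᵢ` remains `i mod 3` throughout. -/
theorem stmt17 {A : Type*} (E : A → A → Prop) (n : ℕ) (hn : 1 ≤ n)
    (α β : ZMod (3 * n) → A)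
    (hα : DirCycleCol (3 * n) E α) (hβ : DirCycleCol (3 * n) E β) :
    IsHColoring (cycleGraph (3 * n)) (pairedRel E) (liftCol (3 * n) α) ∧
    (Relation.ReflTransGen
        (fun f g => DirCycleCol (3 * n) E f ∧ DirCycleCol (3 * n) E g ∧ FDiffOne f g)
        α β ↔
      Relation.ReflTransGen (RecolorStep (cycleGraph (3 * n)) (pairedRel E))
        (liftCol (3 * n) α) (liftCol (3 * n) β)) ∧
    (∀ g : ZMod (3 * n) → A × ZMod 3,
      Relation.ReflTransGen (RecolorStep (cycleGraph (3 * n)) (pairedRel E))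
        (liftCol (3 * n) α) g →
      ∀ i : ZMod (3 * n), (g i).2 = (i.val : ZMod 3)) := by
  refine ⟨isHColoring_liftCol hn hα, ⟨fun h => ?_, fun h => ?_⟩,
    fun g hg => snd_eq_of_reflTransGen_recolorStep hn hg fun _ => rfl⟩
  · exact h.lift (liftCol (3 * n)) fun f g ⟨hf, hg, hfg⟩ =>
      ⟨isHColoring_liftCol hn hf, isHColoring_liftCol hn hg, hfg.liftCol⟩
  · refine Relation.ReflTransGen.trans_induction_on
      (motive := fun {f g} _ => (∀ i, (f i).2 = (i.val : ZMod 3)) →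
        Relation.ReflTransGen
          (fun f g => DirCycleCol (3 * n) E f ∧ DirCycleCol (3 * n) E g ∧ FDiffOne f g)
          (fun i => (f i).1) (fun i => (g i).1)) h (fun _ _ => .refl) ?_ ?_ fun _ => rfl
    · intro f g hstep hf
      have hg := hstep.snd_eq hn hf
      exact .single ⟨dirCycleCol_fst_of_isHColoring hn hstep.1 hf,
        dirCycleCol_fst_of_isHColoring hn hstep.2.1 hg,
        hstep.2.2.fst fun i => (hf i).trans (hg i).symm⟩
    · intro f g k hfg _ ihf ihg hf
      exact (ihf hf).trans (ihg (snd_eq_of_reflTransGen_recolorStep hn hfg hf))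
end
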